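/- arXiv:2503.01708 — 4 statements merged into one kernel-verified Lean document; each statement's English description precedes it below -/
import Mathlib

section
/- Let β₁ > 0 and β₂, β₃, β₄ ∈ ℝ. Define g_{U,0}(y,w) = −(y − β₂w − β₄)²/(2β₁) − (1/2)log(2πβ₁) and g_{U,1}(y,w) = −(1/2)(y − w)² − ((β₃ − 1)/2)w², and let P₀ be the Gaussian measure N(β₄, β₁) on ℝ (which has density e^{g_{U,0}(·,0)} with respect to Lebesgue measure). Then the information parameters of the inference task (g_{U,0}, g_{U,1}) are exactly (β₁, β₂, β₃, β₄): that is, E_{P₀}[(∂_w g_{U,1}(Y,0) − E_{P₀}[∂_w g_{U,1}(Y,0)])²] = β₁, E_{P₀}[∂_w g_{U,1}(Y,0) ∂_w g_{U,0}(Y,0)] = β₂, −E_{P₀}[∂²_w g_{U,1}(Y,0)] = β₃ and E_{P₀}[∂_w g_{U,1}(Y,0)] = β₄. Consequently every inference task with information parameters (β₁,β₂,β₃,β₄) is strongly equivalent to (g_{U,0}, g_{U,1}). -/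
open MeasureTheory ProbabilityTheory

/-- The universal null log-likelihood
`g_{U,0}(y,w) = −(y − β₂w − β₄)²/(2β₁) − (1/2)log(2πβ₁)`. -/
noncomputable def gU0 (b1 b2 b4 : ℝ) (y w : ℝ) : ℝ :=
  -(y - b2 * w - b4) ^ 2 / (2 * b1) - (1 / 2) * Real.log (2 * Real.pi * b1)

/-- The universal pseudo log-likelihood
`g_{U,1}(y,w) = −(1/2)(y − w)² − ((β₃ − 1)/2)w²`. -/
noncomputable def gU1 (b3 : ℝ) (y w : ℝ) : ℝ :=
  -(1 / 2) * (y - w) ^ 2 - ((b3 - 1) / 2) * w ^ 2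

lemma exp_gU0_zero {b1 : ℝ} (hb1 : 0 < b1) (b2 b4 y : ℝ) :
    Real.exp (gU0 b1 b2 b4 y 0) = gaussianPDFReal b4 b1.toNNReal y := by
  have h : 0 < 2 * Real.pi * b1 := by positivity
  rw [gU0, Real.exp_sub, one_div, inv_mul_eq_div, ← Real.log_sqrt h.le,
    Real.exp_log (Real.sqrt_pos.mpr h), gaussianPDFReal, Real.coe_toNNReal _ hb1.le,
    mul_zero, sub_zero, div_eq_inv_mul]

lemma hasDerivAt_gU0 (b1 b2 b4 y w : ℝ) :
    HasDerivAt (gU0 b1 b2 b4 y) (b2 / b1 * (y - b2 * w - b4)) w := by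
  have h := ((((((hasDerivAt_id w).const_mul b2).const_sub y).sub_const b4).fun_pow
    2).fun_neg.div_const (2 * b1)).sub_const ((1 / 2) * Real.log (2 * Real.pi * b1))
  refine HasDerivAt.congr_deriv h ?_
  simp only [id_eq, Nat.add_one_sub_one, pow_one, Nat.cast_ofNat]
  rcases eq_or_ne b1 0 with rfl | hb1
  · simp
  · field_simp

lemma hasDerivAt_gU1 (b3 y w : ℝ) : HasDerivAt (gU1 b3 y) (y - b3 * w) w := by
  have h := ((((hasDerivAt_id w).const_sub y).fun_pow 2).const_mul (-(1 / 2))).fun_sub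
    (((hasDerivAt_id w).fun_pow 2).const_mul ((b3 - 1) / 2))
  refine HasDerivAt.congr_deriv h ?_
  simp only [id_eq, Nat.add_one_sub_one, pow_one, Nat.cast_ofNat]
  ring

lemma deriv_gU0_zero (b1 b2 b4 y : ℝ) :
    deriv (gU0 b1 b2 b4 y) 0 = b2 / b1 * (y - b4) := by
  simpa using (hasDerivAt_gU0 b1 b2 b4 y 0).deriv

lemma deriv_gU1_zero (b3 y : ℝ) : deriv (gU1 b3 y) 0 = y := by
  simpa using (hasDerivAt_gU1 b3 y 0).deriv

lemma iteratedDeriv_two_gU1 (b3 y w : ℝ) : iteratedDeriv 2 (gU1 b3 y) w = -b3 := by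
  have h : deriv (gU1 b3 y) = fun w => y - b3 * w :=
    funext fun w => (hasDerivAt_gU1 b3 y w).deriv
  rw [iteratedDeriv_succ, iteratedDeriv_one, h]
  simp

lemma integral_sub_mean_sq_gaussianReal (m : ℝ) (v : NNReal) :
    ∫ y, (y - m) ^ 2 ∂(gaussianReal m v) = v := by
  have h := variance_eq_integral (μ := gaussianReal m v) (X := fun x : ℝ => x) (by fun_prop)
  rw [variance_fun_id_gaussianReal, integral_id_gaussianReal] at h
  exact h.symm

lemma integral_mul_sub_mean_gaussianReal (m : ℝ) (v : NNReal) :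
    ∫ y, y * (y - m) ∂(gaussianReal m v) = v := by
  have hid : MemLp (fun y : ℝ => y - m) 2 (gaussianReal m v) :=
    (memLp_id_gaussianReal 2).sub (memLp_const m)
  have hint : Integrable (fun y : ℝ => y - m) (gaussianReal m v) :=
    hid.integrable one_le_two
  have hid' : Integrable (fun y : ℝ => y) (gaussianReal m v) :=
    (memLp_id_gaussianReal 1).integrable le_rfl
  have h : ∀ y : ℝ, y * (y - m) = (y - m) ^ 2 + m * (y - m) := fun y => by ring
  simp_rw [h]
  rw [integral_add hid.integrable_sq (hint.const_mul m), integral_const_mul,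
    integral_sub hid' (integrable_const m), integral_sub_mean_sq_gaussianReal,
    integral_id_gaussianReal]
  simp

/-- the Gaussian measure `N(β₄, β₁)` has density `e^{g_{U,0}(·,0)}` w.r.t.
Lebesgue measure, the information parameters of the universal task `(g_{U,0}, g_{U,1})`
are exactly `(β₁, β₂, β₃, β₄)`, and consequently every inference task with information
parameters `(β₁, β₂, β₃, β₄)` is strongly equivalent (has the same information parameters)
to `(g_{U,0}, g_{U,1})`. -/
theorem stmt0 (b1 b2 b3 b4 : ℝ) (hb1 : 0 < b1) :
    (gaussianReal b4 b1.toNNReal =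
      MeasureTheory.volume.withDensity fun y =>
        ENNReal.ofReal (Real.exp (gU0 b1 b2 b4 y 0))) ∧
    (∫ y, (deriv (gU1 b3 y) 0
        - ∫ y', deriv (gU1 b3 y') 0 ∂(gaussianReal b4 b1.toNNReal)) ^ 2
        ∂(gaussianReal b4 b1.toNNReal) = b1) ∧
    (∫ y, deriv (gU1 b3 y) 0 * deriv (gU0 b1 b2 b4 y) 0 ∂(gaussianReal b4 b1.toNNReal)
        = b2) ∧
    (-∫ y, iteratedDeriv 2 (gU1 b3 y) 0 ∂(gaussianReal b4 b1.toNNReal) = b3) ∧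
    (∫ y, deriv (gU1 b3 y) 0 ∂(gaussianReal b4 b1.toNNReal) = b4) ∧
    (∀ (P : Measure ℝ) (g₀' g' : ℝ → ℝ → ℝ),
      ((∫ y, (deriv (g' y) 0 - ∫ y', deriv (g' y') 0 ∂P) ^ 2 ∂P = b1) ∧
       (∫ y, deriv (g' y) 0 * deriv (g₀' y) 0 ∂P = b2) ∧
       (-∫ y, iteratedDeriv 2 (g' y) 0 ∂P = b3) ∧
       (∫ y, deriv (g' y) 0 ∂P = b4)) →
      ((∫ y, (deriv (g' y) 0 - ∫ y', deriv (g' y') 0 ∂P) ^ 2 ∂P =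
          ∫ y, (deriv (gU1 b3 y) 0
            - ∫ y', deriv (gU1 b3 y') 0 ∂(gaussianReal b4 b1.toNNReal)) ^ 2
            ∂(gaussianReal b4 b1.toNNReal)) ∧
       (∫ y, deriv (g' y) 0 * deriv (g₀' y) 0 ∂P =
          ∫ y, deriv (gU1 b3 y) 0 * deriv (gU0 b1 b2 b4 y) 0
            ∂(gaussianReal b4 b1.toNNReal)) ∧
       (-∫ y, iteratedDeriv 2 (g' y) 0 ∂P =
          -∫ y, iteratedDeriv 2 (gU1 b3 y) 0 ∂(gaussianReal b4 b1.toNNReal)) ∧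
       (∫ y, deriv (g' y) 0 ∂P =
          ∫ y, deriv (gU1 b3 y) 0 ∂(gaussianReal b4 b1.toNNReal)))) := by
  have hvar : ((b1.toNNReal : NNReal) : ℝ) = b1 := Real.coe_toNNReal _ hb1.le
  have hv : b1.toNNReal ≠ 0 := (Real.toNNReal_pos.mpr hb1).ne'
  have h1 : ∫ y, (deriv (gU1 b3 y) 0
      - ∫ y', deriv (gU1 b3 y') 0 ∂(gaussianReal b4 b1.toNNReal)) ^ 2
      ∂(gaussianReal b4 b1.toNNReal) = b1 := by
    simp_rw [deriv_gU1_zero, integral_id_gaussianReal]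
    rw [integral_sub_mean_sq_gaussianReal, hvar]
  have h2 : ∫ y, deriv (gU1 b3 y) 0 * deriv (gU0 b1 b2 b4 y) 0
      ∂(gaussianReal b4 b1.toNNReal) = b2 := by
    simp_rw [deriv_gU1_zero, deriv_gU0_zero, mul_left_comm _ (b2 / b1)]
    rw [integral_const_mul, integral_mul_sub_mean_gaussianReal, hvar,
      div_mul_cancel₀ _ hb1.ne']
  have h3 : -∫ y, iteratedDeriv 2 (gU1 b3 y) 0 ∂(gaussianReal b4 b1.toNNReal) = b3 := by
    simp [iteratedDeriv_two_gU1]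
  have h4 : ∫ y, deriv (gU1 b3 y) 0 ∂(gaussianReal b4 b1.toNNReal) = b4 := by
    simp_rw [deriv_gU1_zero, integral_id_gaussianReal]
  refine ⟨?_, h1, h2, h3, h4, ?_⟩
  · rw [gaussianReal_of_var_ne_zero b4 hv]
    simp_rw [exp_gU0_zero hb1, gaussianPDF_def]
  · rintro P g₀' g' ⟨e1, e2, e3, e4⟩
    exact ⟨e1.trans h1.symm, e2.trans h2.symm, e3.trans h3.symm, e4.trans h4.symm⟩
end

section
/- For each N, let y^N ∈ ℝ^N be a deterministic vector with |y_i^N| ≤ C for all i and (1/N)Σ_{i=1}^N y_i^N → 0 as N → ∞, and let x^N = (x_{1,N}, …, x_{N,N}) be a random vector with exchangeable coordinates (i.e. for every permutation σ of {1,…,N}, (x_{σ(1),N}, …, x_{σ(N),N}) has the same law as x^N), with |x_{i,N}| ≤ C almost surely, independent of y^N. Then (1/N) Σ_{i=1}^N x_{i,N} y_i^N → 0 in probability as N → ∞. -/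
open MeasureTheory Filter

section Exchangeable

variable {Ω ι : Type*} [MeasurableSpace Ω] {P : Measure Ω}

theorem integrable_coord_mul_coord [IsFiniteMeasure P] {X : Ω → ι → ℝ} {C : ℝ}
    (hX : Measurable X) (hbd : ∀ᵐ ω ∂P, ∀ i, |X ω i| ≤ C) (i j : ι) :
    Integrable (fun ω => X ω i * X ω j) P := by
  refine Integrable.of_bound (C := C * C) (by fun_prop) ?_
  filter_upwards [hbd] with ω hω
  rw [Real.norm_eq_abs, abs_mul]
  exact mul_le_mul (hω i) (hω j) (abs_nonneg _) ((abs_nonneg _).trans (hω i))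

theorem abs_integral_coord_mul_coord_le [IsProbabilityMeasure P] {X : Ω → ι → ℝ} {C : ℝ}
    (hbd : ∀ᵐ ω ∂P, ∀ i, |X ω i| ≤ C) (i j : ι) :
    |∫ ω, X ω i * X ω j ∂P| ≤ C ^ 2 := by
  have h : ∀ᵐ ω ∂P, ‖X ω i * X ω j‖ ≤ C ^ 2 := by
    filter_upwards [hbd] with ω hω
    rw [Real.norm_eq_abs, abs_mul, sq]
    exact mul_le_mul (hω i) (hω j) (abs_nonneg _) ((abs_nonneg _).trans (hω i))
  simpa using norm_integral_le_of_norm_le_const h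

theorem integral_coord_mul_coord_perm {X : Ω → ι → ℝ} (hX : Measurable X)
    {σ : Equiv.Perm ι} (hσ : Measure.map (fun ω i => X ω (σ i)) P = Measure.map X P)
    (i j : ι) :
    ∫ ω, X ω (σ i) * X ω (σ j) ∂P = ∫ ω, X ω i * X ω j ∂P := by
  have hf : Measurable fun v : ι → ℝ => v i * v j := by fun_prop
  have hXσ : Measurable fun ω i => X ω (σ i) := by fun_prop
  rw [← integral_map (φ := X) (f := fun v => v i * v j) hX.aemeasurable hf.aestronglyMeasurable,
    ← hσ, integral_map hXσ.aemeasurable hf.aestronglyMeasurable]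

/-- The mixed second moments of an exchangeable vector take one value on the diagonal and one
value off the diagonal. -/
theorem exists_integral_coord_mul_coord_eq [DecidableEq ι] [IsProbabilityMeasure P]
    {X : Ω → ι → ℝ} {C : ℝ} (hX : Measurable X) (hbd : ∀ᵐ ω ∂P, ∀ i, |X ω i| ≤ C)
    (hexch : ∀ σ : Equiv.Perm ι, Measure.map (fun ω i => X ω (σ i)) P = Measure.map X P) :
    ∃ a b : ℝ, |a| ≤ C ^ 2 ∧ |b| ≤ C ^ 2 ∧
      ∀ i j, ∫ ω, X ω i * X ω j ∂P = if i = j then a else b := by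
  have ha : ∃ a : ℝ, |a| ≤ C ^ 2 ∧ ∀ i, ∫ ω, X ω i * X ω i ∂P = a := by
    rcases isEmpty_or_nonempty ι with hι | ⟨⟨p⟩⟩
    · exact ⟨0, by simpa using sq_nonneg C, fun i => isEmptyElim i⟩
    · refine ⟨_, abs_integral_coord_mul_coord_le hbd p p, fun i => ?_⟩
      simpa using integral_coord_mul_coord_perm hX (hexch (Equiv.swap p i)) p p
  have hb : ∃ b : ℝ, |b| ≤ C ^ 2 ∧ ∀ i j, i ≠ j → ∫ ω, X ω i * X ω j ∂P = b := by
    by_cases h : ∃ p q : ι, p ≠ q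
    · obtain ⟨p, q, hpq⟩ := h
      refine ⟨_, abs_integral_coord_mul_coord_le hbd p q, fun i j hij => ?_⟩
      obtain ⟨σ, rfl, rfl⟩ := MulAction.is_two_pretransitive_iff.mp
        (Equiv.Perm.isMultiplyPretransitive ι 2) hpq hij
      exact integral_coord_mul_coord_perm hX (hexch σ) p q
    · push Not at h
      exact ⟨0, by simpa using sq_nonneg C, fun i j hij => absurd (h i j) hij⟩
  obtain ⟨a, ha, ha'⟩ := ha
  obtain ⟨b, hb, hb'⟩ := hb
  refine ⟨a, b, ha, hb, fun i j => ?_⟩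
  split_ifs with hij
  · rw [← hij, ha']
  · exact hb' i j hij

theorem integrable_sq_sum_coord_mul [Fintype ι] [IsFiniteMeasure P] {X : Ω → ι → ℝ} {C : ℝ}
    (hX : Measurable X) (hbd : ∀ᵐ ω ∂P, ∀ i, |X ω i| ≤ C) (y : ι → ℝ) :
    Integrable (fun ω => (∑ i, X ω i * y i) ^ 2) P := by
  simp_rw [sq, Finset.sum_mul_sum, mul_mul_mul_comm]
  exact integrable_finsetSum _ fun i _ => integrable_finsetSum _ fun j _ =>
    (integrable_coord_mul_coord hX hbd i j).mul_const _

theorem integral_sq_sum_coord_mul_le [Fintype ι] [IsProbabilityMeasure P]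
    {X : Ω → ι → ℝ} {C : ℝ} (hX : Measurable X) (hbd : ∀ᵐ ω ∂P, ∀ i, |X ω i| ≤ C)
    (hexch : ∀ σ : Equiv.Perm ι, Measure.map (fun ω i => X ω (σ i)) P = Measure.map X P)
    (y : ι → ℝ) :
    ∫ ω, (∑ i, X ω i * y i) ^ 2 ∂P ≤ C ^ 2 * (2 * ∑ i, y i ^ 2 + (∑ i, y i) ^ 2) := by
  classical
  obtain ⟨a, b, ha, hb, hab⟩ := exists_integral_coord_mul_coord_eq hX hbd hexch
  have key : ∫ ω, (∑ i, X ω i * y i) ^ 2 ∂P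
      = (a - b) * ∑ i, y i ^ 2 + b * (∑ i, y i) ^ 2 := by
    have hprod i j := (integrable_coord_mul_coord hX hbd i j).mul_const (y i * y j)
    have hite (i j : ι) : (if i = j then a else b) * (y i * y j)
        = (if i = j then (a - b) * (y i * y j) else 0) + b * (y i * y j) := by
      split_ifs <;> ring
    simp_rw [sq, Finset.sum_mul_sum, mul_mul_mul_comm]
    rw [integral_finsetSum _ fun i _ => integrable_finsetSum _ fun j _ => hprod i j]
    simp_rw [integral_finsetSum _ fun j _ => hprod _ j, integral_mul_const, hab, hite,
      Finset.sum_add_distrib, Finset.sum_ite_eq, Finset.mem_univ, if_true, Finset.mul_sum]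
  have h1 : (a - b) * ∑ i, y i ^ 2 ≤ 2 * C ^ 2 * ∑ i, y i ^ 2 :=
    mul_le_mul_of_nonneg_right (by linarith [(abs_le.mp ha).2, (abs_le.mp hb).1])
      (Finset.sum_nonneg fun i _ => sq_nonneg _)
  have h2 : b * (∑ i, y i) ^ 2 ≤ C ^ 2 * (∑ i, y i) ^ 2 :=
    mul_le_mul_of_nonneg_right (abs_le.mp hb).2 (sq_nonneg _)
  linarith

end Exchangeable

/-- if `y^N` is a deterministic triangular array bounded by `C` with
`(1/N)Σᵢ yᵢ^N → 0`, and `x^N` is a triangular array of exchangeable random vectors bounded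
by `C`, then `(1/N)Σᵢ x_{i,N} y_i^N → 0` in probability. -/
theorem stmt9 (C : ℝ) (hC : 0 < C)
    (y : (N : ℕ) → Fin N → ℝ) (hybd : ∀ N i, |y N i| ≤ C)
    (hy : Tendsto (fun N : ℕ => (1 / (N : ℝ)) * ∑ i, y N i) atTop (nhds 0))
    (Ω : Type*) [MeasurableSpace Ω] (P : Measure Ω) [IsProbabilityMeasure P]
    (X : (N : ℕ) → Ω → Fin N → ℝ) (hXmeas : ∀ N, Measurable (X N))
    (hXbd : ∀ N, ∀ᵐ ω ∂P, ∀ i, |X N ω i| ≤ C)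
    (hexch : ∀ (N : ℕ) (σ : Equiv.Perm (Fin N)),
      Measure.map (fun ω => fun i => X N ω (σ i)) P = Measure.map (X N) P) :
    ∀ ε : ℝ, 0 < ε →
      Tendsto (fun N : ℕ => P {ω | ε ≤ |(1 / (N : ℝ)) * ∑ i, X N ω i * y N i|})
        atTop (nhds 0) := by
  intro ε hε
  have hlim : Tendsto (fun N : ℕ => C ^ 2 * (2 * C ^ 2 * (1 / (N : ℝ))
      + ((1 / (N : ℝ)) * ∑ i, y N i) ^ 2) / ε ^ 2) atTop (nhds 0) := by
    simpa using (((tendsto_one_div_atTop_nhds_zero_nat (𝕜 := ℝ)).const_mul (2 * C ^ 2)).add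
      (hy.pow 2)).const_mul (C ^ 2) |>.div_const (ε ^ 2)
  refine tendsto_of_tendsto_of_tendsto_of_le_of_le tendsto_const_nhds
    (by simpa using ENNReal.tendsto_ofReal hlim) (fun _ => zero_le) fun N => ?_
  have hsq : ∑ i, y N i ^ 2 ≤ N * C ^ 2 := by
    simpa using Finset.sum_le_card_nsmul Finset.univ (fun i => y N i ^ 2) (C ^ 2)
      fun i _ => sq_le_sq' (abs_le.mp (hybd N i)).1 (abs_le.mp (hybd N i)).2
  have hmarkov := mul_meas_ge_le_integral_of_nonneg (μ := P)
    (f := fun ω => (1 / (N : ℝ)) ^ 2 * (∑ i, X N ω i * y N i) ^ 2)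
    (ae_of_all _ fun ω => by positivity)
    ((integrable_sq_sum_coord_mul (hXmeas N) (hXbd N) (y N)).const_mul _) (ε ^ 2)
  have hset : {ω | ε ≤ |(1 / (N : ℝ)) * ∑ i, X N ω i * y N i|}
      = {ω | ε ^ 2 ≤ (1 / (N : ℝ)) ^ 2 * (∑ i, X N ω i * y N i) ^ 2} := by
    ext ω
    rw [Set.mem_ofPred_eq, Set.mem_ofPred_eq, ← mul_pow, sq_le_sq, abs_of_pos hε]
  have hmoment := integral_sq_sum_coord_mul_le (hXmeas N) (hXbd N) (hexch N) (y N)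
  rw [integral_const_mul] at hmarkov
  have hN : (1 / (N : ℝ)) ^ 2 * N = 1 / N := by
    rcases eq_or_ne (N : ℝ) 0 with h | h
    · simp [h]
    · field_simp
  rw [← ofReal_measureReal, hset]
  refine ENNReal.ofReal_le_ofReal ?_
  rw [le_div_iff₀' (by positivity)]
  refine hmarkov.trans ?_
  calc (1 / (N : ℝ)) ^ 2 * ∫ ω, (∑ i, X N ω i * y N i) ^ 2 ∂P
      ≤ (1 / (N : ℝ)) ^ 2 * (C ^ 2 * (2 * (N * C ^ 2) + (∑ i, y N i) ^ 2)) := by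
        refine mul_le_mul_of_nonneg_left (hmoment.trans ?_) (by positivity)
        gcongr
    _ = C ^ 2 * (2 * C ^ 2 * ((1 / (N : ℝ)) ^ 2 * N)
          + ((1 / (N : ℝ)) * ∑ i, y N i) ^ 2) := by ring
    _ = _ := by rw [hN, one_div]
end

section
/- Let λ > 0, let Φ denote the standard normal cumulative distribution function, and set g(y,w) = ((1−y)/2)·log Φ(−λw) + ((1+y)/2)·log Φ(λw) for y ∈ {−1, 1}. Let P₀ be the uniform measure on {−1, 1}. (This g is the log-likelihood of observing the sign of a standard Gaussian shifted by λw, since P(Y = 1 | w) = Φ(λw).) Then the information parameters of the well-specified censored spiked matrix task (g, g) are β₁ = β₂ = β₃ = 2λ²/π and β₄ = 0. -/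
open MeasureTheory
open scoped ENNReal

/-- The standard normal cumulative distribution function. -/
noncomputable def Phi (t : ℝ) : ℝ :=
  (Real.sqrt (2 * Real.pi))⁻¹ * ∫ s in Set.Iic t, Real.exp (-s ^ 2 / 2)

/-- The censored (sign-observation) log-likelihood with SNR `λ`:
`g(y,w) = ((1−y)/2)·log Φ(−λw) + ((1+y)/2)·log Φ(λw)` for `y ∈ {−1,1}`. -/
noncomputable def gCens (lam : ℝ) (y w : ℝ) : ℝ :=
  ((1 - y) / 2) * Real.log (Phi (-(lam * w))) + ((1 + y) / 2) * Real.log (Phi (lam * w))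

/-- The uniform null measure on `{−1, 1} ⊂ ℝ`. -/
noncomputable def unifSigns : Measure ℝ :=
  ((1 : ℝ≥0∞) / 2) • Measure.dirac (-1 : ℝ) + ((1 : ℝ≥0∞) / 2) • Measure.dirac (1 : ℝ)

/-- The standard normal density. -/
noncomputable def stdNormalDensity (t : ℝ) : ℝ :=
  (Real.sqrt (2 * Real.pi))⁻¹ * Real.exp (-t ^ 2 / 2)

theorem integrable_exp_neg_sq_div_two : Integrable fun s : ℝ => Real.exp (-s ^ 2 / 2) := by
  refine (integrable_exp_neg_mul_sq (b := 1 / 2) (by norm_num)).congr (.of_forall fun s => ?_)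
  simp only
  ring_nf

theorem Phi_pos (t : ℝ) : 0 < Phi t := by
  have : NeZero (volume.restrict (Set.Iic t) : Measure ℝ) := ⟨by simp⟩
  exact mul_pos (by positivity) (integral_exp_pos integrable_exp_neg_sq_div_two.integrableOn)

theorem Phi_zero : Phi 0 = 1 / 2 := by
  have h : ∫ s in Set.Iic (0 : ℝ), Real.exp (-s ^ 2 / 2) = Real.sqrt (2 * Real.pi) / 2 := by
    have h₁ := integral_comp_neg_Iic (0 : ℝ) fun s => Real.exp (-s ^ 2 / 2)
    have h₂ := integral_gaussian_Ioi (1 / 2)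
    simp only [neg_sq, neg_zero] at h₁
    rw [h₁]
    convert h₂ using 3 <;> ring_nf
  rw [Phi, h]
  have : Real.sqrt (2 * Real.pi) ≠ 0 := by positivity
  field_simp

theorem hasDerivAt_Phi (t : ℝ) : HasDerivAt Phi (stdNormalDensity t) t := by
  have hc : Continuous fun s : ℝ => Real.exp (-s ^ 2 / 2) := by fun_prop
  have h := (hc.integral_hasStrictDerivAt 0 t).hasDerivAt
  have hPhi : Phi = fun u => (Real.sqrt (2 * Real.pi))⁻¹ *
      ((∫ s in Set.Iic (0 : ℝ), Real.exp (-s ^ 2 / 2)) + ∫ s in (0 : ℝ)..u,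
        Real.exp (-s ^ 2 / 2)) := by
    funext u
    rw [← intervalIntegral.integral_Iic_sub_Iic integrable_exp_neg_sq_div_two.integrableOn
      integrable_exp_neg_sq_div_two.integrableOn, add_sub_cancel, Phi]
  rw [hPhi]
  exact (h.const_add _).const_mul _

theorem hasDerivAt_stdNormalDensity (t : ℝ) :
    HasDerivAt stdNormalDensity (-t * stdNormalDensity t) t := by
  have h : HasDerivAt (fun s : ℝ => -s ^ 2 / 2) (-t) t := by
    refine ((hasDerivAt_pow 2 t).neg.div_const 2).congr_deriv ?_
    norm_num
    ring
  refine (h.exp.const_mul (Real.sqrt (2 * Real.pi))⁻¹).congr_deriv ?_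
  rw [stdNormalDensity]
  ring

theorem stdNormalDensity_zero_sq : stdNormalDensity 0 ^ 2 = 1 / (2 * Real.pi) := by
  simp only [stdNormalDensity, ne_eq, OfNat.ofNat_ne_zero, not_false_eq_true, zero_pow, neg_zero,
    zero_div, Real.exp_zero, mul_one, inv_pow]
  rw [Real.sq_sqrt (by positivity), one_div]

theorem hasDerivAt_log_Phi_mul (a w : ℝ) :
    HasDerivAt (fun w => Real.log (Phi (a * w)))
      (a * (stdNormalDensity (a * w) / Phi (a * w))) w := by
  have ha : HasDerivAt (fun w : ℝ => a * w) a w := by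
    simpa using (hasDerivAt_id w).const_mul a
  refine (((hasDerivAt_Phi (a * w)).comp w ha).log (Phi_pos _).ne').congr_deriv ?_
  rw [Function.comp_apply]
  ring

theorem hasDerivAt_deriv_log_Phi_mul_zero (a : ℝ) :
    HasDerivAt (fun w => a * (stdNormalDensity (a * w) / Phi (a * w)))
      (-(2 * a ^ 2 / Real.pi)) 0 := by
  have ha : HasDerivAt (fun w : ℝ => a * w) a 0 := by
    simpa using (hasDerivAt_id (0 : ℝ)).const_mul a
  have h := ((hasDerivAt_stdNormalDensity (a * 0)).div (hasDerivAt_Phi (a * 0)) (Phi_pos _).ne')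
  refine ((h.comp 0 ha).const_mul a).congr_deriv ?_
  have hsq := stdNormalDensity_zero_sq
  rw [mul_zero, Phi_zero]
  have : a * ((-0 * stdNormalDensity 0 * (1 / 2) - stdNormalDensity 0 * stdNormalDensity 0) /
      (1 / 2) ^ 2 * a) = -(4 * a ^ 2 * stdNormalDensity 0 ^ 2) := by ring
  rw [this, hsq]
  field_simp
  ring

theorem hasDerivAt_gCens (lam y w : ℝ) :
    HasDerivAt (gCens lam y)
      ((1 - y) / 2 * (-lam * (stdNormalDensity (-lam * w) / Phi (-lam * w))) +
        (1 + y) / 2 * (lam * (stdNormalDensity (lam * w) / Phi (lam * w)))) w := by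
  refine (((hasDerivAt_log_Phi_mul (-lam) w).const_mul ((1 - y) / 2)).add
    ((hasDerivAt_log_Phi_mul lam w).const_mul ((1 + y) / 2))).congr_of_eventuallyEq
    (.of_forall fun u => ?_)
  simp [gCens]

theorem deriv_gCens_zero (lam y : ℝ) :
    deriv (gCens lam y) 0 = 2 * lam * stdNormalDensity 0 * y := by
  rw [(hasDerivAt_gCens lam y 0).deriv, mul_zero, mul_zero, Phi_zero]
  ring

theorem iteratedDeriv_two_gCens_zero (lam y : ℝ) :
    iteratedDeriv 2 (gCens lam y) 0 = -(2 * lam ^ 2 / Real.pi) := by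
  rw [iteratedDeriv_succ, iteratedDeriv_one, funext fun w => (hasDerivAt_gCens lam y w).deriv]
  refine (((hasDerivAt_deriv_log_Phi_mul_zero (-lam)).const_mul ((1 - y) / 2)).add
    ((hasDerivAt_deriv_log_Phi_mul_zero lam).const_mul ((1 + y) / 2))).deriv.trans ?_
  ring

theorem integral_unifSigns (f : ℝ → ℝ) : ∫ y, f y ∂unifSigns = (f (-1) + f 1) / 2 := by
  have h (a : ℝ) : Integrable f (((1 : ℝ≥0∞) / 2) • Measure.dirac a) :=
    (integrable_dirac (by simp)).smul_measure (by simp)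
  rw [unifSigns, integral_add_measure (h _) (h _)]
  simp only [integral_smul_measure, integral_dirac, smul_eq_mul]
  norm_num
  ring

/-- for the well-specified censored spiked matrix task `(g, g)` — observing
the signs of a spiked Gaussian matrix — with uniform null model on `{−1,1}`, the
information parameters are `β₁ = β₂ = β₃ = 2λ²/π` and `β₄ = 0`. -/
theorem stmt17 (lam : ℝ) (hlam : 0 < lam) :
    (∫ y, (deriv (gCens lam y) 0 - ∫ y', deriv (gCens lam y') 0 ∂unifSigns) ^ 2 ∂unifSigns
        = 2 * lam ^ 2 / Real.pi) ∧
    (∫ y, deriv (gCens lam y) 0 * deriv (gCens lam y) 0 ∂unifSigns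
        = 2 * lam ^ 2 / Real.pi) ∧
    (-∫ y, iteratedDeriv 2 (gCens lam y) 0 ∂unifSigns = 2 * lam ^ 2 / Real.pi) ∧
    (∫ y, deriv (gCens lam y) 0 ∂unifSigns = 0) := by
  have hsq : (2 * lam * stdNormalDensity 0) ^ 2 = 2 * lam ^ 2 / Real.pi := by
    rw [mul_pow, stdNormalDensity_zero_sq]
    field_simp
  simp only [integral_unifSigns, deriv_gCens_zero, iteratedDeriv_two_gCens_zero, ← hsq]
  refine ⟨?_, ?_, ?_, ?_⟩ <;> ring
end

section
/- Fix p ∈ (0,1) and λ > 0, and consider the sparse Rademacher data model on {−1, 0, 1}: P(Y = 1 | w) = P(Y = −1 | w) = p/2 + λw and P(Y = 0 | w) = 1 − p − 2λw for |w| small, with null model P₀ given by w = 0 (i.e. P₀({±1}) = p/2, P₀({0}) = 1 − p). The true score at w = 0 is ∂_w g₀(y,0) = 2λ/p for y = ±1 and ∂_w g₀(0,0) = −2λ/(1 − p). For the Gaussian pseudo-likelihood g(y,w) = −(y − λw)²/2 (the best rank-one / least-squares objective), whose score is ∂_w g(y,0) = λy, the information parameters of (g₀, g) are β₁ = Var_{P₀}(λY)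 = λ²p, β₂ = λ·E_{P₀}[Y ∂_w g₀(Y,0)] = 0, β₃ = λ², and β₄ = λ·E_{P₀}[Y] = 0. In particular β₂ = β₄ = 0, so the least-squares pseudo-likelihood is well-scored but carries no signal information in the sparse Rademacher model. -/
open MeasureTheory
open scoped ENNReal

/-- The sparse Rademacher null measure on `{−1,0,1} ⊂ ℝ`:
`P₀({±1}) = p/2`, `P₀({0}) = 1 − p`. -/
noncomputable def sparseRad (p : ℝ) : Measure ℝ :=
  ENNReal.ofReal (p / 2) • Measure.dirac (-1 : ℝ) +
    ENNReal.ofReal (p / 2) • Measure.dirac (1 : ℝ) +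
    ENNReal.ofReal (1 - p) • Measure.dirac (0 : ℝ)

/-- The sparse Rademacher log-likelihood `g₀(y,w) = log P(Y = y | w)`, i.e.
`log(p/2 + λw)` for `y = ±1` and `log(1 − p − 2λw)` for `y = 0`. -/
noncomputable def gSR (p lam : ℝ) (y w : ℝ) : ℝ :=
  if y = 0 then Real.log (1 - p - 2 * lam * w) else Real.log (p / 2 + lam * w)

/-- The Gaussian (least-squares / best rank-one) pseudo-likelihood
`g(y,w) = −(y − λw)²/2`. -/
noncomputable def gLS (lam : ℝ) (y w : ℝ) : ℝ := -(y - lam * w) ^ 2 / 2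

theorem hasDerivAt_gLS (lam y w : ℝ) :
    HasDerivAt (gLS lam y) (lam * (y - lam * w)) w := by
  have h : HasDerivAt (fun w => y - lam * w) (-(lam * 1)) w :=
    ((hasDerivAt_id w).const_mul lam).const_sub y
  refine ((h.pow 2).neg.div_const 2).congr_deriv ?_
  push_cast
  ring

theorem deriv_gLS (lam y : ℝ) : deriv (gLS lam y) = fun w => lam * (y - lam * w) :=
  funext fun w => (hasDerivAt_gLS lam y w).deriv

theorem iteratedDeriv_two_gLS (lam y w : ℝ) :
    iteratedDeriv 2 (gLS lam y) w = -lam ^ 2 := by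
  rw [iteratedDeriv_succ, iteratedDeriv_one, deriv_gLS]
  have h : HasDerivAt (fun w => lam * (y - lam * w)) (lam * -(lam * 1)) w :=
    (((hasDerivAt_id w).const_mul lam).const_sub y).const_mul lam
  rw [h.deriv]
  ring

theorem deriv_gSR_of_ne_zero {p y : ℝ} (lam : ℝ) (hp : 0 < p) (hy : y ≠ 0) :
    deriv (gSR p lam y) 0 = 2 * lam / p := by
  have h : HasDerivAt (fun w => p / 2 + lam * w) (lam * 1) 0 :=
    ((hasDerivAt_id (0 : ℝ)).const_mul lam).const_add (p / 2)
  have hg : gSR p lam y = fun w => Real.log (p / 2 + lam * w) := by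
    funext w
    simp [gSR, hy]
  rw [hg, (h.log (by simp [hp.ne'])).deriv]
  simp only [mul_zero, add_zero, mul_one]
  field_simp

theorem deriv_gSR_zero {p : ℝ} (lam : ℝ) (hp : p < 1) :
    deriv (gSR p lam 0) 0 = -(2 * lam / (1 - p)) := by
  have h : HasDerivAt (fun w => 1 - p - 2 * lam * w) (-(2 * lam * 1)) 0 :=
    ((hasDerivAt_id (0 : ℝ)).const_mul (2 * lam)).const_sub (1 - p)
  have hg : gSR p lam 0 = fun w => Real.log (1 - p - 2 * lam * w) := by
    funext w
    simp [gSR]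
  rw [hg, (h.log (by simpa using (sub_pos.2 hp).ne')).deriv]
  simp [neg_div]

theorem integral_sparseRad {p : ℝ} (hp : 0 ≤ p) (hp1 : p ≤ 1) (f : ℝ → ℝ) :
    ∫ y, f y ∂(sparseRad p) = p / 2 * f (-1) + p / 2 * f 1 + (1 - p) * f 0 := by
  have hi (c a : ℝ) : Integrable f (ENNReal.ofReal c • Measure.dirac a) :=
    (integrable_dirac (by simp)).smul_measure ENNReal.ofReal_ne_top
  rw [sparseRad, integral_add_measure ((hi _ _).add_measure (hi _ _)) (hi _ _),
    integral_add_measure (hi _ _) (hi _ _)]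
  simp only [integral_smul_measure, integral_dirac, smul_eq_mul]
  rw [ENNReal.toReal_ofReal (by linarith), ENNReal.toReal_ofReal (by linarith)]

/-- in the sparse Rademacher model, the true score at `w = 0` is `2λ/p` for
`y = ±1` and `−2λ/(1−p)` for `y = 0`; the Gaussian pseudo-likelihood has score `λy`, and
the information parameters of `(g₀, g)` are `β₁ = λ²p`, `β₂ = 0`, `β₃ = λ²`, `β₄ = 0` —
the least-squares pseudo-likelihood is well-scored but carries no signal information. -/
theorem stmt19 (p lam : ℝ) (hp : 0 < p) (hp1 : p < 1) (hlam : 0 < lam) :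
    (deriv (gSR p lam 1) 0 = 2 * lam / p) ∧
    (deriv (gSR p lam (-1)) 0 = 2 * lam / p) ∧
    (deriv (gSR p lam 0) 0 = -(2 * lam / (1 - p))) ∧
    (∀ y : ℝ, deriv (gLS lam y) 0 = lam * y) ∧
    (∫ y, (deriv (gLS lam y) 0 - ∫ y', deriv (gLS lam y') 0 ∂(sparseRad p)) ^ 2
        ∂(sparseRad p) = lam ^ 2 * p) ∧
    (∫ y, deriv (gLS lam y) 0 * deriv (gSR p lam y) 0 ∂(sparseRad p) = 0) ∧
    (-∫ y, iteratedDeriv 2 (gLS lam y) 0 ∂(sparseRad p) = lam ^ 2) ∧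
    (∫ y, deriv (gLS lam y) 0 ∂(sparseRad p) = 0) := by
  have hs (y : ℝ) : deriv (gLS lam y) 0 = lam * y := by simp [deriv_gLS]
  have h_mean : ∫ y, deriv (gLS lam y) 0 ∂(sparseRad p) = 0 := by
    rw [integral_sparseRad hp.le hp1.le]
    simp only [hs]
    ring
  refine ⟨deriv_gSR_of_ne_zero lam hp one_ne_zero, deriv_gSR_of_ne_zero lam hp (by norm_num),
    deriv_gSR_zero lam hp1, hs, ?_, ?_, ?_, h_mean⟩
  · rw [h_mean, integral_sparseRad hp.le hp1.le]
    simp only [hs]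
    ring
  · rw [integral_sparseRad hp.le hp1.le, deriv_gSR_of_ne_zero lam hp one_ne_zero,
      deriv_gSR_of_ne_zero lam hp (by norm_num : (-1 : ℝ) ≠ 0)]
    simp only [hs]
    ring
  · rw [integral_sparseRad hp.le hp1.le]
    simp only [iteratedDeriv_two_gLS]
    ring
end
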